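/- arXiv:math/0511413 — 7 statements merged into one kernel-verified Lean document; each statement's English description precedes it below -/
import Mathlib

section
/- Let L be a finite-dimensional Lie algebra over a field k of characteristic zero, and let B be a k-subspace of L that is invariant under every Lie algebra automorphism of L. Then B is invariant under every derivation of L. -/
open Polynomial TensorProduct

theorem exists_aeval_eq_of_equivariant {k F : Type*} [Field k] [Field F] [Algebra k F]
    [FiniteDimensional k F] [IsGalois k F] (s : Finset F)
    (hs : ∀ σ : F ≃ₐ[k] F, ∀ x ∈ s, σ x ∈ s) (r : F → F)
    (hr : ∀ σ : F ≃ₐ[k] F, ∀ x ∈ s, r (σ x) = σ (r x)) :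
    ∃ f : k[X], ∀ x ∈ s, aeval x f = r x := by
  classical
  have hinj : Set.InjOn (id : F → F) s := Function.injective_id.injOn
  obtain ⟨P, hdeg, heval⟩ : ∃ P : F[X], P.degree < s.card ∧ ∀ x ∈ s, P.eval x = r x :=
    ⟨Lagrange.interpolate s id r, Lagrange.degree_interpolate_lt r hinj,
      fun x hx => Lagrange.eval_interpolate_at_node r hinj hx⟩
  have hfix (σ : F ≃ₐ[k] F) : P.map (σ : F →+* F) = P := by
    refine eq_of_degrees_lt_of_eval_index_eq s hinj (degree_map_le.trans_lt hdeg) hdeg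
      fun x hx => ?_
    have hx' : σ.symm x ∈ s := hs σ.symm x hx
    have h := eval_map_apply (p := P) (σ : F →+* F) (σ.symm x)
    rw [heval _ hx'] at h
    simpa [← hr σ _ hx', heval x hx] using h
  have hlift : P ∈ lifts (algebraMap k F) := by
    rw [lifts_iff_coeff_lifts]
    intro n
    rw [IsGalois.mem_range_algebraMap_iff_fixed]
    intro σ
    simpa using congrArg (fun p => coeff p n) (hfix σ)
  obtain ⟨f, hf⟩ := hlift
  refine ⟨f, fun x hx => ?_⟩
  rw [← heval x hx, ← hf, coe_mapRingHom, eval_map_algebraMap]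

theorem exists_int_valued_separating {V : Type*} [AddCommGroup V] [Module ℚ V] (s : Finset V) :
    ∃ n : V → ℤ, Set.InjOn n s ∧
      ∀ x ∈ s, ∀ y ∈ s, x + y ∈ s → n (x + y) = n x + n y := by
  classical
  obtain ⟨φ, hφ⟩ := Module.exists_dual_forall_apply_ne_zero (K := ℚ)
    (fun p : s.offDiag => p.1.1 - p.1.2)
    (fun p => sub_ne_zero.2 (Finset.mem_offDiag.1 p.2).2.2)
  obtain ⟨b, hb⟩ := IsLocalization.exist_integer_multiples (nonZeroDivisors ℤ) s (fun x => φ x)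
  have hb0 : ((b : ℤ) : ℚ) ≠ 0 := Int.cast_ne_zero.2 (nonZeroDivisors.ne_zero b.2)
  have hb' : ∀ x ∈ s, ∃ m : ℤ, (m : ℚ) = (b : ℤ) * φ x := fun x hx => by
    obtain ⟨m, hm⟩ := hb x hx
    exact ⟨m, by simpa using hm⟩
  choose! n hn using hb'
  refine ⟨n, fun x hx y hy hxy => ?_, fun x hx y hy hxy => ?_⟩
  · by_contra hne
    refine hφ ⟨(x, y), Finset.mem_offDiag.2 ⟨hx, hy, hne⟩⟩ ?_
    have h := hn x hx
    rw [hxy, hn y hy] at h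
    simp [mul_left_cancel₀ hb0 h]
  · have h := hn _ hxy
    rw [map_add, mul_add, ← hn x hx, ← hn y hy] at h
    exact_mod_cast h

theorem exists_prod_galois_zpow_ne_one {k F : Type*} [Field k] [CharZero k] [Field F]
    [Algebra k F] [FiniteDimensional k F] (M : Finset ((F ≃ₐ[k] F) → ℤ))
    (hM : ∀ m ∈ M, m 1 ≠ 0) :
    ∃ u : F, u ≠ 0 ∧ ∀ m ∈ M, ∏ σ : F ≃ₐ[k] F, σ u ^ m σ ≠ 1 := by
  classical
  have : CharZero F := charZero_of_injective_algebraMap (algebraMap k F).injective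
  obtain ⟨α, hα⟩ := Field.exists_primitive_element k F
  have hα' (σ : F ≃ₐ[k] F) (h : σ α = α) : σ = 1 := by
    have hadj : Algebra.adjoin k {α} = ⊤ := by
      rw [← IntermediateField.adjoin_simple_toSubalgebra_of_isAlgebraic
        (Algebra.IsAlgebraic.isAlgebraic α), hα, IntermediateField.top_toSubalgebra]
    have : (σ : F →ₐ[k] F) = AlgHom.id k F :=
      AlgHom.ext_of_adjoin_eq_top hadj (by simpa using h)
    ext x
    exact DFunLike.congr_fun this x
  let P (m : (F ≃ₐ[k] F) → ℤ) : F[X] := ∏ σ : F ≃ₐ[k] F, (X + C (σ α)) ^ (m σ).toNat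
  have hP (m : (F ≃ₐ[k] F) → ℤ) : (P m).eval (-α) = 0 ↔ 0 < m 1 := by
    simp only [P, eval_prod, Finset.prod_eq_zero_iff, eval_pow, eval_add, eval_X, eval_C,
      Finset.mem_univ, true_and, pow_eq_zero_iff']
    constructor
    · rintro ⟨σ, h1, h2⟩
      rw [neg_add_eq_zero] at h1
      rw [hα' σ h1.symm] at h2
      omega
    · intro h
      exact ⟨1, by simp, by omega⟩
  let R : F[X] := (∏ m ∈ M, (P m - P (-m))) * ∏ σ : F ≃ₐ[k] F, (X + C (σ α))
  have hR : R ≠ 0 := by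
    refine mul_ne_zero (Finset.prod_ne_zero_iff.2 fun m hm h0 => ?_)
      (Finset.prod_ne_zero_iff.2 fun σ _ => X_add_C_ne_zero _)
    have h1 := hP m
    have h2 := hP (-m)
    rw [← sub_eq_zero.1 h0, h1, Pi.neg_apply] at h2
    have := hM m hm
    omega
  obtain ⟨t, ht⟩ : ∃ t : ℕ, R.eval (t : F) ≠ 0 := by
    by_contra! h
    refine hR (eq_zero_of_infinite_isRoot R ((Set.infinite_range_of_injective
      (Nat.cast_injective (R := F))).mono ?_))
    rintro _ ⟨t, rfl⟩
    exact h t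
  simp only [R, eval_mul, eval_prod, mul_ne_zero_iff, Finset.prod_ne_zero_iff, eval_sub,
    eval_add, eval_X, eval_C] at ht
  obtain ⟨ht1, ht2⟩ := ht
  have hu (σ : F ≃ₐ[k] F) : (t : F) + σ α = σ (t + α) := by simp
  have hne (σ : F ≃ₐ[k] F) : σ (t + α) ≠ 0 := hu σ ▸ ht2 σ (Finset.mem_univ _)
  refine ⟨t + α, hne 1, fun m hm h => ht1 m hm ?_⟩
  have hz (σ : F ≃ₐ[k] F) : σ (t + α) ^ m σ =
      σ (t + α) ^ (m σ).toNat / σ (t + α) ^ ((-m) σ).toNat := by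
    rw [← zpow_natCast, ← zpow_natCast, ← zpow_sub₀ (hne σ), Pi.neg_apply]
    congr 1
    omega
  simp only [hz, Finset.prod_div_distrib] at h
  rw [div_eq_one_iff_eq (Finset.prod_ne_zero_iff.2 fun σ _ => pow_ne_zero _ (hne σ))] at h
  simp only [P, eval_prod, eval_pow, eval_add, eval_X, eval_C, hu, h, sub_self]

theorem exists_equivariant_character {k F : Type*} [Field k] [CharZero k] [Field F]
    [Algebra k F] [FiniteDimensional k F] (s : Finset F)
    (hs : ∀ σ : F ≃ₐ[k] F, ∀ x ∈ s, σ x ∈ s) :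
    ∃ χ : F → F, (∀ x, χ x ≠ 0) ∧ Set.InjOn χ s ∧
      (∀ σ : F ≃ₐ[k] F, ∀ x, χ (σ x) = σ (χ x)) ∧
      ∀ x ∈ s, ∀ y ∈ s, x + y ∈ s → χ (x + y) = χ x * χ y := by
  classical
  have : CharZero F := charZero_of_injective_algebraMap (algebraMap k F).injective
  obtain ⟨n, hninj, hnadd⟩ := exists_int_valued_separating s
  obtain ⟨u, hu0, hu⟩ := exists_prod_galois_zpow_ne_one (k := k)
    (s.offDiag.image fun p (σ : F ≃ₐ[k] F) => n (σ.symm p.1) - n (σ.symm p.2)) (by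
      simp only [Finset.mem_image, Finset.mem_offDiag]
      rintro _ ⟨⟨x, y⟩, ⟨hx, hy, hxy⟩, rfl⟩
      exact sub_ne_zero.2 fun h => hxy (hninj hx hy h))
  have hσu (σ : F ≃ₐ[k] F) : σ u ≠ 0 := by simpa using hu0
  have hne (x : F) : ∏ σ : F ≃ₐ[k] F, σ u ^ n (σ.symm x) ≠ 0 :=
    Finset.prod_ne_zero_iff.2 fun σ _ => zpow_ne_zero _ (hσu σ)
  refine ⟨fun x => ∏ σ : F ≃ₐ[k] F, σ u ^ n (σ.symm x), hne, ?_, ?_, ?_⟩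
  · intro x hx y hy hxy
    by_contra hne'
    refine hu _ (Finset.mem_image_of_mem _
      (Finset.mem_offDiag (x := (x, y)).2 ⟨hx, hy, hne'⟩)) ?_
    simp only [zpow_sub₀ (hσu _), Finset.prod_div_distrib]
    rw [div_eq_one_iff_eq (hne y)]
    exact hxy
  · intro τ x
    simp only [map_prod, map_zpow₀]
    refine (Fintype.prod_equiv (Equiv.mulLeft τ) _ _ fun σ => ?_).symm
    have h : (Equiv.mulLeft τ σ).symm (τ x) = σ.symm x := by
      rw [AlgEquiv.symm_apply_eq]; simp
    rw [h, Equiv.coe_mulLeft, AlgEquiv.mul_apply]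
  · intro x hx y hy hxy
    simp only [← Finset.prod_mul_distrib]
    refine Finset.prod_congr rfl fun σ _ => ?_
    rw [map_add, hnadd _ (hs _ _ hx) _ (hs _ _ hy) (map_add σ.symm x y ▸ hs _ _ hxy),
      zpow_add₀ (hσu σ)]

theorem exists_polynomial_character {k : Type*} [Field k] [CharZero k] (K : Type*) [Field K]
    [Algebra k K] [IsAlgClosed K] {q : k[X]} (hq : q ≠ 0) :
    ∃ f f' g : k[X], (∀ x ∈ q.rootSet K, aeval x (f * f') = 1 ∧ aeval x (g.comp f) = x) ∧
      ∀ x ∈ q.rootSet K, ∀ y ∈ q.rootSet K, x + y ∈ q.rootSet K →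
        aeval (x + y) f = aeval x f * aeval y f := by
  classical
  let F := q.SplittingField
  have : IsGalois k F := ⟨⟩
  let s : Finset F := (q.rootSet F).toFinset
  have hs (σ : F ≃ₐ[k] F) (x) (hx : x ∈ s) : σ x ∈ s := by
    simp only [s, Set.mem_toFinset, mem_rootSet_of_ne hq] at hx ⊢
    rw [aeval_algHom_apply, hx, map_zero]
  obtain ⟨χ, h0, hinj, heq, hadd⟩ := exists_equivariant_character s hs
  obtain ⟨f, hf⟩ := exists_aeval_eq_of_equivariant s hs χ fun σ x _ => heq σ x
  obtain ⟨f', hf'⟩ := exists_aeval_eq_of_equivariant s hs (fun x => (χ x)⁻¹)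
    fun σ x _ => by simp [heq]
  have hinv (x) (hx : x ∈ s) : Function.invFunOn χ s (χ x) = x := hinj.leftInvOn_invFunOn hx
  obtain ⟨g, hg⟩ := exists_aeval_eq_of_equivariant (k := k) (s.image χ)
    (fun σ y hy => by
      obtain ⟨x, hx, rfl⟩ := Finset.mem_image.1 hy
      exact Finset.mem_image.2 ⟨σ x, hs σ x hx, heq σ x⟩)
    (Function.invFunOn χ s)
    (fun σ y hy => by
      obtain ⟨x, hx, rfl⟩ := Finset.mem_image.1 hy
      rw [← heq, hinv x hx, hinv _ (hs σ x hx)])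
  have hsplit : (q.map (algebraMap k F)).Splits := SplittingField.splits q
  let ι : F →ₐ[k] K := IsAlgClosed.lift
  have hroot (x) (hx : x ∈ q.rootSet K) : ∃ z ∈ s, ι z = x := by
    rw [← hsplit.image_rootSet ι] at hx
    simpa [s] using hx
  refine ⟨f, f', g, fun x hx => ?_, fun x hx y hy hxy => ?_⟩
  · obtain ⟨z, hz, rfl⟩ := hroot x hx
    rw [aeval_algHom_apply, aeval_algHom_apply, map_mul, aeval_comp, hf z hz, hf' z hz,
      hg _ (Finset.mem_image_of_mem χ hz), hinv z hz, mul_inv_cancel₀ (h0 z), map_one]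
    exact ⟨rfl, rfl⟩
  · obtain ⟨z, hz, rfl⟩ := hroot x hx
    obtain ⟨w, hw, rfl⟩ := hroot y hy
    obtain ⟨v, hv, hvzw⟩ := hroot _ hxy
    rw [← map_add] at hvzw
    obtain rfl := ι.injective hvzw
    rw [← map_add, aeval_algHom_apply, aeval_algHom_apply, aeval_algHom_apply, ← map_mul,
      hf z hz, hf w hw, hf _ hv, hadd z hz w hw hv]

section GeneralizedEigenspaces

variable {K V : Type*} [Field K] [LieRing V] [LieAlgebra K V]

theorem lie_mem_maxGenEigenspace_of_leibniz {D : Module.End K V}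
    (hD : ∀ x y, D ⁅x, y⁆ = ⁅D x, y⁆ + ⁅x, D y⁆) {a b : K} {x y : V}
    (hx : x ∈ D.maxGenEigenspace a) (hy : y ∈ D.maxGenEigenspace b) :
    ⁅x, y⁆ ∈ D.maxGenEigenspace (a + b) := by
  rw [Module.End.mem_maxGenEigenspace] at hx hy ⊢
  obtain ⟨n, hn⟩ := hx
  obtain ⟨m, hm⟩ := hy
  refine ⟨n + m, ?_⟩
  have key (x y : V) : (D - (a + b) • (1 : Module.End K V)) ⁅x, y⁆ =
      ⁅(D - a • (1 : Module.End K V)) x, y⁆ + ⁅x, (D - b • (1 : Module.End K V)) y⁆ := by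
    simp [hD, add_smul]
    abel
  induction n generalizing x y m with
  | zero => simp_all
  | succ n ihn =>
    induction m generalizing x y with
    | zero => simp_all
    | succ m ihm =>
      rw [← add_assoc, pow_succ, Module.End.mul_apply, key, map_add]
      rw [pow_succ, Module.End.mul_apply] at hn hm
      rw [show n + 1 + m = n + (m + 1) by omega, ihn hn (m + 1) (by rwa [pow_succ]), zero_add,
        show n + (m + 1) = n + 1 + m by omega]
      exact ihm (by rwa [pow_succ]) hm

theorem induction_on_maxGenEigenspace₂ {D : Module.End K V}
    (hD : ⨆ a, D.maxGenEigenspace a = ⊤) {p : V → V → Prop}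
    (h : ∀ a, ∀ x ∈ D.maxGenEigenspace a, ∀ b, ∀ y ∈ D.maxGenEigenspace b, p x y)
    (hzero_left : ∀ y, p 0 y) (hzero_right : ∀ x, p x 0)
    (hadd_left : ∀ x x' y, p x y → p x' y → p (x + x') y)
    (hadd_right : ∀ x y y', p x y → p x y' → p x (y + y')) (x y : V) : p x y := by
  have hx : x ∈ ⨆ a, D.maxGenEigenspace a := hD ▸ Submodule.mem_top
  have hy : y ∈ ⨆ a, D.maxGenEigenspace a := hD ▸ Submodule.mem_top
  induction hx using Submodule.iSup_induction' with
  | mem a x hx =>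
    induction hy using Submodule.iSup_induction' with
    | mem b y hy => exact h a x hx b y hy
    | zero => exact hzero_right x
    | add y y' _ _ h h' => exact hadd_right x y y' h h'
  | zero => exact hzero_left y
  | add x x' _ _ h h' => exact hadd_left x x' y h h'

end GeneralizedEigenspaces

section BaseChange

variable {k L : Type*} [Field k] [LieRing L] [LieAlgebra k L] (K : Type*) [Field K] [Algebra k K]

theorem baseChange_aeval (S : Module.End k L) (p : k[X]) :
    (aeval S p).baseChange K = aeval (S.baseChange K) (p.map (algebraMap k K)) := by
  rw [aeval_map_algebraMap]
  exact (aeval_algHom_apply (Module.End.baseChangeHom k K L) S p).symm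

theorem baseChange_injective : Function.Injective
    (fun f : Module.End k L => f.baseChange K) := by
  intro f g hfg
  ext x
  refine Module.FaithfullyFlat.tensorProduct_mk_injective (A := k) (B := K) L ?_
  simpa using LinearMap.congr_fun hfg (1 ⊗ₜ x)

theorem baseChange_leibniz (D : LieDerivation k L L) (x y : K ⊗[k] L) :
    D.toLinearMap.baseChange K ⁅x, y⁆ =
      ⁅D.toLinearMap.baseChange K x, y⁆ + ⁅x, D.toLinearMap.baseChange K y⁆ := by
  induction x with
  | zero => simp
  | add x x' hx hx' => simp only [add_lie, map_add, hx, hx']; abel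
  | tmul a x =>
    induction y with
    | zero => simp
    | add y y' hy hy' => simp only [lie_add, map_add, hy, hy']; abel
    | tmul b y =>
      simp [LieAlgebra.ExtendScalars.bracket_tmul, tmul_add, D.apply_lie_eq_add, add_comm]

end BaseChange

theorem semisimplePart_apply_of_mem_maxGenEigenspace {k L : Type*} [Field k] [CharZero k]
    [LieRing L] [LieAlgebra k L]
    [FiniteDimensional k L] (K : Type*) [Field K] [Algebra k K]
    {D N S : Module.End k L} (hN : IsNilpotent N) (hS : S.IsSemisimple) (hc : Commute N S)
    (hD : D = N + S) {a : K} {x : K ⊗[k] L}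
    (hx : x ∈ Module.End.maxGenEigenspace (D.baseChange K) a) :
    S.baseChange K x = a • x := by
  have hss : Module.End.IsSemisimple (S.baseChange K) := by
    refine Module.End.isSemisimple_of_squarefree_aeval_eq_zero
      (p := (minpoly k S).map (algebraMap k K))
      (PerfectField.separable_iff_squarefree.2 hS.minpoly_squarefree).map.squarefree ?_
    rw [← baseChange_aeval, minpoly.aeval, LinearMap.baseChange_zero]
  have hnil : IsNilpotent (N.baseChange K) := hN.map (Module.End.baseChangeHom k K L)
  have hcomm : Commute (N.baseChange K) (S.baseChange K) := hc.map (Module.End.baseChangeHom k K L)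
  subst hD
  rw [LinearMap.baseChange_add] at hx
  exact Module.End.apply_eq_of_mem_of_comm_of_isFinitelySemisimple_of_isNil hx
    (hcomm.add_left (Commute.refl _)) hss.isFinitelySemisimple (by simpa using hnil)

theorem aeval_apply_of_apply_eq_smul {K V : Type*} [Field K] [AddCommGroup V] [Module K V]
    {S : Module.End K V} {a : K} {x : V} (h : S x = a • x) (p : K[X]) :
    aeval S p x = p.eval a • x := by
  by_cases hx : x = 0
  · simp [hx]
  · exact Module.End.aeval_apply_of_hasEigenvector
      ⟨Module.End.mem_eigenspace_iff.2 h, hx⟩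

theorem aeval_apply_mem {k V : Type*} [Field k] [AddCommGroup V] [Module k V]
    {T : Module.End k V} {B : Submodule k V} (hT : ∀ x ∈ B, T x ∈ B) (p : k[X]) :
    ∀ x ∈ B, aeval T p x ∈ B := by
  induction p using Polynomial.induction_on' with
  | add p q hp hq =>
    intro x hx
    rw [map_add]
    exact B.add_mem (hp x hx) (hq x hx)
  | monomial n a =>
    intro x hx
    rw [aeval_monomial, Module.End.mul_apply, Module.algebraMap_end_apply]
    refine B.smul_mem a ?_
    induction n generalizing x with
    | zero => simpa
    | succ n ih =>
      rw [pow_succ, Module.End.mul_apply]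
      exact ih _ (hT x hx)

theorem apply_mem_of_exp_apply_mem {k V : Type*} [Field k] [CharZero k] [AddCommGroup V]
    [Module k V] [Module ℚ V] {N : Module.End k V} (hN : IsNilpotent N) {B : Submodule k V}
    (hB : ∀ x ∈ B, IsNilpotent.exp N x ∈ B) : ∀ x ∈ B, N x ∈ B := by
  obtain ⟨n, hn⟩ := hN
  obtain ⟨p, hp⟩ : ∃ p : k[X], aeval N (X * (1 + X * p)) = IsNilpotent.exp N - 1 := by
    refine ⟨∑ i ∈ Finset.range n, C (((i + 2).factorial : k)⁻¹) * X ^ i, ?_⟩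
    have hn' : N ^ (n + 2) = 0 := by rw [pow_add, hn, zero_mul]
    have hq (q : ℚ) (f : Module.End k V) : q • f = (q : k) • f :=
      (Rat.cast_smul_eq_qsmul k q f).symm
    rw [IsNilpotent.exp_eq_sum hn', Finset.sum_range_succ', Finset.sum_range_succ']
    simp only [hq, map_mul, map_add, map_sum, aeval_X, map_one, map_pow, aeval_C, mul_add,
      Finset.mul_sum, ← Algebra.smul_def, mul_smul_comm]
    simp only [← pow_succ', zero_add, pow_zero, pow_one, Nat.factorial_zero,
      Nat.factorial_one, Nat.cast_one, inv_one, Rat.cast_one, one_smul, mul_one, add_assoc,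
      Nat.reduceAdd, Rat.cast_inv, Rat.cast_natCast]
    abel
  have hE : ∀ x ∈ B, aeval N (X * (1 + X * p)) x ∈ B := fun x hx => by
    rw [hp, LinearMap.sub_apply]
    exact B.sub_mem (hB x hx) hx
  have key (d : ℕ) : ∀ j, n ≤ j + d → ∀ r : k[X], ∀ x ∈ B, aeval N (X ^ (j + 1) * r) x ∈ B := by
    induction d with
    | zero =>
      intro j hj r x _
      have : N ^ (j + 1) = 0 := pow_eq_zero_of_le (by omega) hn
      simp [this]
    | succ d ih =>
      intro j hj r x hx
      have hX : aeval N ((X : k[X]) ^ (j + 1)) x ∈ B := by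
        obtain ⟨w, hw⟩ : (X : k[X]) ∣ (1 + X * p) ^ (j + 1) - 1 := by
          have h := sub_dvd_pow_sub_pow (1 + X * p) 1 (j + 1)
          rw [one_pow, add_sub_cancel_left] at h
          exact (dvd_mul_right (X : k[X]) p).trans h
        have h : (X : k[X]) ^ (j + 1) = (X * (1 + X * p)) ^ (j + 1) - X ^ (j + 1 + 1) * w := by
          rw [mul_pow, sub_eq_iff_eq_add.1 hw]
          ring
        rw [h, map_sub, LinearMap.sub_apply, map_pow]
        refine B.sub_mem ?_ (ih (j + 1) (by omega) w x hx)
        simpa using aeval_apply_mem hE (X ^ (j + 1)) x hx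
      have h : (X : k[X]) ^ (j + 1) * r =
          C (r.coeff 0) * X ^ (j + 1) + X ^ (j + 1 + 1) * r.divX := by
        linear_combination X ^ (j + 1) * (divX_mul_X_add r).symm
      rw [h, map_add, LinearMap.add_apply, map_mul, aeval_C, ← Algebra.smul_def,
        LinearMap.smul_apply]
      exact B.add_mem (B.smul_mem _ hX) (ih (j + 1) (by omega) _ x hx)
  intro x hx
  simpa using key n 0 (by omega) 1 x hx

section SemisimplePart

variable {k L : Type*} [Field k] [CharZero k] [LieRing L] [LieAlgebra k L]
  [FiniteDimensional k L]

theorem semisimplePart_leibniz (D : LieDerivation k L L) {N S : Module.End k L}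
    (hN : IsNilpotent N) (hS : S.IsSemisimple) (hc : Commute N S)
    (hD : D.toLinearMap = N + S) (x y : L) : S ⁅x, y⁆ = ⁅S x, y⁆ + ⁅x, S y⁆ := by
  let K := AlgebraicClosure k
  have hact {a : K} {x : K ⊗[k] L}
      (hx : x ∈ Module.End.maxGenEigenspace (D.toLinearMap.baseChange K) a) :=
    semisimplePart_apply_of_mem_maxGenEigenspace K hN hS hc hD hx
  have h : ∀ x y : K ⊗[k] L,
      S.baseChange K ⁅x, y⁆ = ⁅S.baseChange K x, y⁆ + ⁅x, S.baseChange K y⁆ := by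
    refine induction_on_maxGenEigenspace₂ (Module.End.iSup_maxGenEigenspace_eq_top
      (D.toLinearMap.baseChange K)) (fun a x hx b y hy => ?_) (by simp) (by simp) ?_ ?_
    · rw [hact hx, hact hy, hact (lie_mem_maxGenEigenspace_of_leibniz
        (baseChange_leibniz K D) hx hy), smul_lie, lie_smul, add_smul]
    · intro x x' y h h'
      simp only [add_lie, map_add, h, h']
      abel
    · intro x y y' h h'
      simp only [lie_add, map_add, h, h']
      abel
  refine Module.FaithfullyFlat.tensorProduct_mk_injective (A := k) (B := K) L ?_
  simpa [LieAlgebra.ExtendScalars.bracket_tmul, tmul_add] using h (1 ⊗ₜ x) (1 ⊗ₜ y)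

theorem semisimplePart_apply_mem {B : Submodule k L}
    (hB : ∀ e : L ≃ₗ⁅k⁆ L, ∀ x ∈ B, e x ∈ B)
    (D : LieDerivation k L L) {N S : Module.End k L}
    (hN : IsNilpotent N) (hS : S.IsSemisimple) (hc : Commute N S)
    (hD : D.toLinearMap = N + S) : ∀ x ∈ B, S x ∈ B := by
  let K := AlgebraicClosure k
  have hact {a : K} {x : K ⊗[k] L}
      (hx : x ∈ Module.End.maxGenEigenspace (D.toLinearMap.baseChange K) a) :=
    semisimplePart_apply_of_mem_maxGenEigenspace K hN hS hc hD hx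
  have htop := Module.End.iSup_maxGenEigenspace_eq_top (D.toLinearMap.baseChange K)
  have hact' (p : k[X]) {a : K} {x : K ⊗[k] L}
      (hx : x ∈ Module.End.maxGenEigenspace (D.toLinearMap.baseChange K) a) :
      (aeval S p).baseChange K x = aeval a p • x := by
    rw [baseChange_aeval, aeval_apply_of_apply_eq_smul (hact hx), eval_map_algebraMap]
  have hq : minpoly k S ≠ 0 := minpoly.ne_zero_of_finite k S
  have hroot {a : K} {x : K ⊗[k] L}
      (hx : x ∈ Module.End.maxGenEigenspace (D.toLinearMap.baseChange K) a) (hx0 : x ≠ 0) :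
      a ∈ (minpoly k S).rootSet K := by
    have h := hact' (minpoly k S) hx
    rw [minpoly.aeval, LinearMap.baseChange_zero, LinearMap.zero_apply] at h
    exact (mem_rootSet_of_ne hq).2 ((smul_eq_zero.1 h.symm).resolve_right hx0)
  have hext (p q : k[X]) (h : ∀ a ∈ (minpoly k S).rootSet K, aeval a p = aeval a q) :
      aeval S p = aeval S q := by
    refine baseChange_injective K (LinearMap.ext fun x => ?_)
    have hx : x ∈ ⨆ a, Module.End.maxGenEigenspace (D.toLinearMap.baseChange K) a :=
      htop ▸ Submodule.mem_top
    induction hx using Submodule.iSup_induction' with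
    | mem a x hx =>
      by_cases hx0 : x = 0
      · simp [hx0]
      · exact (hact' p hx).trans (h a (hroot hx hx0) ▸ (hact' q hx).symm)
    | zero => simp
    | add x y _ _ hx hy => simp only [map_add, hx, hy]
  obtain ⟨f, f', g, hfg, hf⟩ := exists_polynomial_character K hq
  have hinv : aeval S f * aeval S f' = 1 := by
    rw [← map_mul, hext (f * f') 1 fun a ha => by rw [(hfg a ha).1, map_one], map_one]
  have hgf : aeval (aeval S f) g = S := by
    rw [← aeval_comp, hext (g.comp f) X fun a ha => by rw [(hfg a ha).2, aeval_X], aeval_X]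
  have hmul : ∀ x y : K ⊗[k] L, (aeval S f).baseChange K ⁅x, y⁆ =
      ⁅(aeval S f).baseChange K x, (aeval S f).baseChange K y⁆ := by
    refine induction_on_maxGenEigenspace₂ htop (fun a x hx b y hy => ?_) (by simp) (by simp)
      ?_ ?_
    · have hxy := lie_mem_maxGenEigenspace_of_leibniz (baseChange_leibniz K D) hx hy
      rw [hact' f hx, hact' f hy, hact' f hxy, smul_lie, lie_smul, smul_smul]
      by_cases h0 : ⁅x, y⁆ = 0
      · simp [h0]
      · rw [hf a (hroot hx fun h => h0 (by simp [h])) b (hroot hy fun h => h0 (by simp [h]))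
          (hroot hxy h0)]
    · intro x x' y h h'
      simp only [add_lie, map_add, h, h']
    · intro x y y' h h'
      simp only [lie_add, map_add, h, h']
  let T : L →ₗ⁅k⁆ L :=
    { aeval S f with
      map_lie' := fun {x y} => by
        refine Module.FaithfullyFlat.tensorProduct_mk_injective (A := k) (B := K) L ?_
        simpa [LieAlgebra.ExtendScalars.bracket_tmul] using hmul (1 ⊗ₜ x) (1 ⊗ₜ y) }
  have hT : Function.Bijective T := by
    have hinv' : aeval S f' * aeval S f = 1 := by rw [← map_mul, mul_comm, map_mul, hinv]
    exact ⟨Function.LeftInverse.injective (LinearMap.congr_fun hinv'),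
      Function.RightInverse.surjective (LinearMap.congr_fun hinv)⟩
  have hTB : ∀ x ∈ B, aeval S f x ∈ B := hB (LieEquiv.ofBijective T hT)
  intro x hx
  have h := aeval_apply_mem hTB g x hx
  rwa [hgf] at h

end SemisimplePart

/-- If `B` is a subspace of a finite-dimensional Lie algebra `L` over a field of
characteristic zero which is invariant under every Lie algebra automorphism of `L`, then `B` is
invariant under every derivation of `L`. -/
theorem stmt0 (k L : Type*) [Field k] [CharZero k] [LieRing L] [LieAlgebra k L]
    [FiniteDimensional k L] (B : Submodule k L)
    (hB : ∀ e : L ≃ₗ⁅k⁆ L, ∀ x ∈ B, e x ∈ B)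
    (D : LieDerivation k L L) : ∀ x ∈ B, D x ∈ B := by
  obtain ⟨N, hNmem, S, hSmem, hN, hS, hD⟩ :=
    Module.End.exists_isNilpotent_isSemisimple (f := D.toLinearMap)
  have hc : Commute N S := Algebra.commute_of_mem_adjoin_singleton_of_commute hSmem
    (Algebra.commute_of_mem_adjoin_self hNmem).symm
  have hN_leibniz (x y : L) : N ⁅x, y⁆ = ⁅x, N y⁆ - ⁅y, N x⁆ := by
    have hDN (z : L) : N z = D z - S z := by
      rw [eq_sub_iff_add_eq]
      exact (LinearMap.congr_fun hD z).symm
    rw [hDN, hDN, hDN, semisimplePart_leibniz D hN hS hc hD, D.apply_lie_eq_sub, lie_sub,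
      lie_sub, ← lie_skew (S x) y]
    abel
  let _ : Module ℚ L := Module.compHom L (algebraMap ℚ k)
  have : IsScalarTower ℚ k L := ⟨fun q a x => by
    rw [Algebra.smul_def, mul_smul]; rfl⟩
  let _ : LieAlgebra ℚ L := { lie_smul := fun q x y => lie_smul (algebraMap ℚ k q) x y }
  let N' : LieDerivation k L L := { N with leibniz' := hN_leibniz }
  intro x hx
  have h : D x = N x + S x := LinearMap.congr_fun hD x
  rw [h]
  exact B.add_mem (apply_mem_of_exp_apply_mem hN (hB (N'.exp hN)) x hx)
    (semisimplePart_apply_mem hB D hN hS hc hD x hx)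
end

section
/- Let L be a finite-dimensional Lie algebra over a field k that is the internal direct sum of two Lie ideals I and J (i.e., I ∩ J = 0 and I + J = L). Then the Frattini subalgebra F(L) is contained in the sum of the images in L of the Frattini subalgebras F(I) and F(J), where I and J are regarded as Lie algebras in their own right. -/
/-- The Frattini subalgebra of a Lie algebra: the intersection of all maximal proper
Lie subalgebras (equal to all of `L` when there are no maximal subalgebras). -/
def lieFrattini (k L : Type*) [Field k] [LieRing L] [LieAlgebra k L] : LieSubalgebra k L :=
  sInf {M : LieSubalgebra k L | IsCoatom M}

/-- The preimage of a maximal subalgebra under a surjective homomorphism is maximal. -/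
theorem LieSubalgebra.isCoatom_comap_of_surjective {k L L' : Type*} [CommRing k]
    [LieRing L] [LieAlgebra k L] [LieRing L'] [LieAlgebra k L'] {f : L →ₗ⁅k⁆ L'}
    (hf : Function.Surjective f) {M : LieSubalgebra k L'} (hM : IsCoatom M) :
    IsCoatom (M.comap f) := by
  refine ⟨fun h => hM.1 (eq_top_iff.2 fun y _ => ?_), fun N hN => eq_top_iff.2 fun z _ => ?_⟩
  · obtain ⟨x, rfl⟩ := hf y
    have hx : x ∈ M.comap f := h ▸ LieSubalgebra.mem_top x
    exact hx
  · obtain ⟨hle, n, hnN, hnM⟩ := SetLike.lt_iff_le_and_exists.1 hN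
    have hlt : M < N.map f := by
      refine SetLike.lt_iff_le_and_exists.2 ⟨fun y hy => ?_, f n, ⟨n, hnN, rfl⟩, hnM⟩
      obtain ⟨x, rfl⟩ := hf y
      exact ⟨x, hle hy, rfl⟩
    have hz : f z ∈ N.map f := hM.2 _ hlt ▸ LieSubalgebra.mem_top (f z)
    obtain ⟨m, hm, hmz⟩ := (LieSubalgebra.mem_map _ _ _).1 hz
    have hker : z - m ∈ M.comap f := by
      change f (z - m) ∈ M
      rw [map_sub, hmz, sub_self]
      exact M.zero_mem
    simpa using N.add_mem (hle hker) hm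

/-- A surjective homomorphism maps the Frattini subalgebra into the Frattini subalgebra. -/
theorem map_mem_lieFrattini {k L L' : Type*} [Field k]
    [LieRing L] [LieAlgebra k L] [LieRing L'] [LieAlgebra k L'] {f : L →ₗ⁅k⁆ L'}
    (hf : Function.Surjective f) {x : L} (hx : x ∈ lieFrattini k L) :
    f x ∈ lieFrattini k L' := by
  simp only [lieFrattini, ← SetLike.mem_coe, LieSubalgebra.coe_sInf, Set.mem_iInter₂] at hx ⊢
  exact fun M hM => hx _ (LieSubalgebra.isCoatom_comap_of_surjective hf hM)

/-- The projection of a Lie algebra onto an ideal along a complementary ideal. -/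
noncomputable def LieIdeal.projectionOfIsCompl {k L : Type*} [CommRing k] [LieRing L]
    [LieAlgebra k L] (I J : LieIdeal k L) (h : IsCompl I.toSubmodule J.toSubmodule) :
    L →ₗ⁅k⁆ I :=
  { Submodule.projectionOnto I.toSubmodule J.toSubmodule h with
    map_lie' := by
      intro x y
      set p := Submodule.projectionOnto I.toSubmodule J.toSubmodule h
      have hJ : ∀ z, z - (p z : L) ∈ J := fun z =>
        (Submodule.projectionOnto_apply_eq_zero_iff h).1 (by
          rw [map_sub, Submodule.projectionOnto_apply_left]; exact sub_self _)
      have hmem : ⁅x, y⁆ - ⁅(p x : L), (p y : L)⁆ ∈ J := by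
        have heq : ⁅x, y⁆ - ⁅(p x : L), (p y : L)⁆
            = ⁅x - (p x : L), y⁆ + ⁅(p x : L), y - (p y : L)⁆ := by
          simp
        rw [heq]
        exact J.add_mem (lie_mem_left k L J _ _ (hJ x)) (lie_mem_right k L J _ _ (hJ y))
      have hzero := (Submodule.projectionOnto_apply_eq_zero_iff h).2 hmem
      rw [map_sub, sub_eq_zero] at hzero
      exact hzero.trans (Submodule.projectionOnto_apply_left h (⁅(show I from p x), (show I from p y)⁆ : I)) }

/-- if `L = I ⊕ J` is an internal direct sum of two ideals, then
`F(L)` is contained in the sum of the images of `F(I)` and `F(J)` in `L`. -/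
theorem stmt9 (k L : Type*) [Field k] [LieRing L] [LieAlgebra k L]
    [FiniteDimensional k L] (I J : LieIdeal k L)
    (hinf : I ⊓ J = ⊥) (hsup : I ⊔ J = ⊤) :
    lieFrattini k L ≤ (lieFrattini k I).map I.incl ⊔ (lieFrattini k J).map J.incl := by
  have h : IsCompl I.toSubmodule J.toSubmodule :=
    LieSubmodule.isCompl_toSubmodule.2 ⟨disjoint_iff.2 hinf, codisjoint_iff.2 hsup⟩
  intro x hx
  have hI := map_mem_lieFrattini (f := I.projectionOfIsCompl J h)
    (Submodule.projectionOnto_surjective h) hx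
  have hJ := map_mem_lieFrattini (f := J.projectionOfIsCompl I h.symm)
    (Submodule.projectionOnto_surjective h.symm) hx
  have hadd : (I.projectionOfIsCompl J h x : L) + (J.projectionOfIsCompl I h.symm x : L) = x :=
    Submodule.projection_add_projection_eq_self h x
  rw [← hadd]
  exact LieSubalgebra.add_mem _
    ((le_sup_left : (lieFrattini k I).map I.incl ≤ _) ⟨_, hI, rfl⟩)
    ((le_sup_right : (lieFrattini k J).map J.incl ≤ _) ⟨_, hJ, rfl⟩)
end

section
/- Let L be a finite-dimensional Lie algebra over a field k, let B be a Lie ideal of L, and let U be a Lie subalgebra of L that is minimal with respect to the property L = B + U (as a sum of subspaces): that is, L = B + U, and no proper Lie subalgebra U' of U satisfies L = B + U'. Then B ∩ U is contained in the Frattini subalgebra F(U) of U, where U is regarded as a Lie algebra in its own right. -/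
/-- The sum of a Lie subalgebra and a Lie ideal, as a Lie subalgebra. -/
def LieSubalgebra.supIdeal {k L : Type*} [CommRing k] [LieRing L] [LieAlgebra k L]
    (M : LieSubalgebra k L) (I : LieIdeal k L) : LieSubalgebra k L where
  toSubmodule := M.toSubmodule ⊔ I.toSubmodule
  lie_mem' := by
    intro x y hx hy
    obtain ⟨m, hm, b, hb, rfl⟩ := Submodule.mem_sup.1 hx
    obtain ⟨n, hn, c, hc, rfl⟩ := Submodule.mem_sup.1 hy
    rw [lie_add, add_lie, add_assoc]
    exact Submodule.add_mem_sup (M.lie_mem hm hn)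
      (I.add_mem (lie_mem_left k L I b n hb) (lie_mem_right k L I (m + b) c hc))

theorem LieSubalgebra.mem_supIdeal {k L : Type*} [CommRing k] [LieRing L] [LieAlgebra k L]
    {M : LieSubalgebra k L} {I : LieIdeal k L} {x : L} :
    x ∈ M.supIdeal I ↔ ∃ m ∈ M, ∃ b ∈ I, m + b = x :=
  Submodule.mem_sup

/-- A maximal subalgebra not containing an element of an ideal supplements that ideal. -/
theorem LieSubalgebra.supIdeal_eq_top {k L : Type*} [CommRing k] [LieRing L] [LieAlgebra k L]
    {M : LieSubalgebra k L} (hM : IsCoatom M) {I : LieIdeal k L} {x : L}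
    (hxI : x ∈ I) (hxM : x ∉ M) : M.supIdeal I = ⊤ := by
  refine hM.2 _ (lt_of_le_of_ne (fun m hm => ?_) fun h => hxM ?_)
  · exact mem_supIdeal.2 ⟨m, hm, 0, I.zero_mem, add_zero m⟩
  · rw [h]
    exact mem_supIdeal.2 ⟨0, M.zero_mem, x, hxI, zero_add x⟩

/-- if `B` is an ideal and `U` is a subalgebra minimal with respect to the
property `L = B + U`, then `B ∩ U ⊆ F(U)`. -/
theorem stmt10 (k L : Type*) [Field k] [LieRing L] [LieAlgebra k L]
    [FiniteDimensional k L] (B : LieIdeal k L) (U : LieSubalgebra k L)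
    (hBU : B.toSubmodule ⊔ U.toSubmodule = ⊤)
    (hmin : ∀ U' : LieSubalgebra k L, U' ≤ U → B.toSubmodule ⊔ U'.toSubmodule = ⊤ → U' = U) :
    ∀ (x : L) (hx : x ∈ B) (hxU : x ∈ U), (⟨x, hxU⟩ : U) ∈ lieFrattini k U := by
  intro x hx hxU
  rw [lieFrattini, ← SetLike.mem_coe, LieSubalgebra.coe_sInf, Set.mem_iInter₂]
  intro M hM
  by_contra hxM
  have hMI := LieSubalgebra.supIdeal_eq_top (I := B.comap U.incl) hM hx hxM
  have hle : U.toSubmodule ≤ B.toSubmodule ⊔ (M.map U.incl).toSubmodule := by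
    intro u hu
    have hu' : (⟨u, hu⟩ : U) ∈ M.supIdeal (B.comap U.incl) := by simp [hMI]
    obtain ⟨m, hm, b, hb, h⟩ := LieSubalgebra.mem_supIdeal.1 hu'
    exact Submodule.mem_sup.2 ⟨b, hb, m, ⟨m, hm, rfl⟩,
      (add_comm _ _).trans (congrArg Subtype.val h)⟩
  have hMU : M.map U.incl = U := by
    refine hmin _ ?_ (top_le_iff.1 (hBU ▸ sup_le le_sup_left hle))
    rintro _ ⟨m, -, rfl⟩
    exact m.2
  refine hM.1 (eq_top_iff.2 fun u _ => ?_)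
  have hu : (u : L) ∈ M.map U.incl := hMU.symm ▸ u.2
  obtain ⟨m, hm, h⟩ := hu
  exact (Subtype.ext h : m = u) ▸ hm
end

section
/- Let L be a finite-dimensional elementary Lie algebra over a field k and let B be a Lie ideal of L. Then the quotient Lie algebra L/B is elementary. -/
/-- A Lie algebra is elementary if every Lie subalgebra has trivial Frattini subalgebra. -/
def IsElementaryLieAlgebra (k L : Type*) [Field k] [LieRing L] [LieAlgebra k L] : Prop :=
  ∀ C : LieSubalgebra k L, lieFrattini k C = ⊥

/-- A Lie algebra isomorphism carries a trivial Frattini subalgebra to a trivial one. -/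
theorem lieFrattini_eq_bot_of_equiv {k L L' : Type*} [Field k] [LieRing L] [LieAlgebra k L]
    [LieRing L'] [LieAlgebra k L'] (e : L ≃ₗ⁅k⁆ L') (h : lieFrattini k L = ⊥) :
    lieFrattini k L' = ⊥ := by
  let φ : LieSubalgebra k L' ≃o LieSubalgebra k L :=
    { toFun := fun M => M.comap e.toLieHom
      invFun := fun M => M.comap e.symm.toLieHom
      left_inv := fun M => by ext x; simp
      right_inv := fun M => by ext x; simp
      map_rel_iff' := by
        intro M N
        refine ⟨fun hMN x hx => ?_, fun hMN x hx => hMN hx⟩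
        have := @hMN (e.symm x) (by simpa using hx)
        simpa using this }
  have hφ : φ (lieFrattini k L') = lieFrattini k L := by
    rw [lieFrattini, lieFrattini, φ.map_sInf_eq_sInf_symm_preimage]
    congr 1
    ext M
    exact φ.symm.isCoatom_iff M
  rw [h] at hφ
  exact (map_eq_bot_iff φ).mp hφ

/-- If no maximal subalgebra of `C` has the same image as `C` under a Lie algebra homomorphism,
then the kernel of that homomorphism lies in the Frattini subalgebra of `C`. -/
theorem mem_lieFrattini_of_apply_eq_zero {k C L' : Type*} [Field k] [LieRing C] [LieAlgebra k C]
    [LieRing L'] [LieAlgebra k L'] (g : C →ₗ⁅k⁆ L')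
    (hg : ∀ M : LieSubalgebra k C, IsCoatom M → M.map g ≠ g.range) {x : C} (hx : g x = 0) :
    x ∈ lieFrattini k C := by
  rw [lieFrattini, ← SetLike.mem_coe, LieSubalgebra.coe_sInf, Set.mem_iInter₂]
  intro M hM
  by_contra hxM
  refine hg M hM (le_antisymm ?_ ?_)
  · rintro _ ⟨y, -, rfl⟩
    exact ⟨y, rfl⟩
  · have hlt : M < (M.map g).comap g := by
      refine lt_of_le_of_ne (fun y hy => ⟨y, hy, rfl⟩) fun h => hxM ?_
      rw [h]
      exact ⟨0, M.zero_mem, by simpa using hx.symm⟩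
    rintro _ ⟨y, rfl⟩
    have hy : y ∈ (M.map g).comap g := by
      rw [hM.2 _ hlt]
      exact LieSubalgebra.mem_top y
    exact hy

/-- The image of a finite-dimensional elementary Lie algebra under a surjective homomorphism is
elementary. -/
theorem IsElementaryLieAlgebra.of_surjective {k L L' : Type*} [Field k] [LieRing L]
    [LieAlgebra k L] [FiniteDimensional k L] [LieRing L'] [LieAlgebra k L']
    (hL : IsElementaryLieAlgebra k L) (f : L →ₗ⁅k⁆ L') (hf : Function.Surjective f) :
    IsElementaryLieAlgebra k L' := by
  intro D
  have hwf : WellFounded ((· < ·) : LieSubalgebra k L → LieSubalgebra k L → Prop) :=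
    Subrelation.wf (r := InvImage (· < ·) LieSubalgebra.toSubmodule) (fun h => h)
      (InvImage.wf _ wellFounded_lt)
  obtain ⟨C, hC, hmin⟩ := hwf.has_min {C : LieSubalgebra k L | C.map f = D}
    ⟨D.comap f, SetLike.coe_injective (Set.image_preimage_eq _ hf)⟩
  let g : C →ₗ⁅k⁆ L' := f.comp C.incl
  have hrange : g.range = D := by
    rw [← show C.map f = D from hC]
    ext y
    simp [g]
  have hinj : Function.Injective g := by
    refine (injective_iff_map_eq_zero g).mpr fun x hx => ?_
    have hxF : x ∈ lieFrattini k C := by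
      refine mem_lieFrattini_of_apply_eq_zero g (fun M hM h => ?_) hx
      refine hmin (M.map C.incl) ?_ ?_
      · rw [hrange] at h
        change (M.map C.incl).map f = D
        rw [← h]
        exact SetLike.coe_injective (Set.image_image f C.incl M)
      · refine lt_of_le_of_ne ?_ fun heq => hM.1 (eq_top_iff.mpr fun y _ => ?_)
        · rintro _ ⟨y, -, rfl⟩
          exact y.2
        · have hy : (y : L) ∈ M.map C.incl := heq.ge y.2
          obtain ⟨z, hz, hzy⟩ := hy
          exact Subtype.ext (a1 := z) (a2 := y) hzy ▸ hz
    rw [hL C] at hxF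
    exact (LieSubalgebra.mem_bot x).mp hxF
  subst hrange
  exact lieFrattini_eq_bot_of_equiv (LieEquiv.ofInjective g hinj) (hL C)

/-- every quotient of an elementary Lie algebra by an ideal is elementary. -/
theorem stmt13 (k L : Type*) [Field k] [LieRing L] [LieAlgebra k L]
    [FiniteDimensional k L] (hL : IsElementaryLieAlgebra k L) (B : LieIdeal k L) :
    IsElementaryLieAlgebra k (L ⧸ B) := by
  let π : L →ₗ⁅k⁆ L ⧸ B :=
    { (LieSubmodule.Quotient.mk' B : L →ₗ[k] L ⧸ B) with
      map_lie' := fun {x y} => LieSubmodule.Quotient.mk_bracket B x y }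
  exact hL.of_surjective π (LieSubmodule.Quotient.surjective_mk' B)
end

section
/- Let L be a finite-dimensional elementary Lie algebra over a field k of characteristic zero. Then L is complemented: for every Lie subalgebra B of L there exists a Lie subalgebra C of L with B ∩ C = 0 and such that the Lie subalgebra generated by B and C is all of L. -/
/-- A supplement `C` of `B` with trivial Frattini subalgebra that is minimal among the supplements
of `B` is a complement of `B`. -/
theorem LieSubalgebra.inf_eq_bot_of_minimal_supplement {k L : Type*} [Field k] [LieRing L]
    [LieAlgebra k L] {B C : LieSubalgebra k L} (hF : lieFrattini k C = ⊥)
    (hC : Minimal (fun D => B ⊔ D = ⊤) C) : B ⊓ C = ⊥ := by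
  rw [LieSubalgebra.eq_bot_iff]
  rintro x ⟨hxB, hxC⟩
  by_contra hx
  have hxF : (⟨x, hxC⟩ : C) ∉ lieFrattini k C := by
    rw [hF, LieSubalgebra.mem_bot]
    exact fun h => hx (congrArg Subtype.val h)
  obtain ⟨M, hM, hxM⟩ : ∃ M : LieSubalgebra k C, IsCoatom M ∧ (⟨x, hxC⟩ : C) ∉ M := by
    by_contra! h
    refine hxF ?_
    rw [lieFrattini, ← SetLike.mem_coe, LieSubalgebra.coe_sInf]
    exact Set.mem_iInter₂.2 fun M hM => h M hM
  have hMC : M.map C.incl ≤ C := by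
    rintro _ ⟨y, -, rfl⟩
    exact y.2
  have hN : (B ⊔ M.map C.incl).comap C.incl = ⊤ := by
    refine hM.2 _ (lt_of_le_of_ne ?_ ?_)
    · exact fun y hy => (le_sup_right : M.map C.incl ≤ _) ⟨y, hy, rfl⟩
    · intro h
      apply hxM
      rw [h]
      exact (le_sup_left : B ≤ B ⊔ M.map C.incl) hxB
  have hCN : C ≤ B ⊔ M.map C.incl := by
    intro y hy
    have : (⟨y, hy⟩ : C) ∈ (B ⊔ M.map C.incl).comap C.incl := hN ▸ LieSubalgebra.mem_top _
    exact this
  have hsup : B ⊔ M.map C.incl = ⊤ := top_le_iff.1 (hC.prop ▸ sup_le le_sup_left hCN)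
  obtain ⟨y, hy, hyx⟩ := hC.le_of_le hsup hMC hxC
  exact hxM ((Subtype.ext hyx : y = ⟨x, hxC⟩) ▸ hy)

/-- a finite-dimensional elementary Lie algebra over a field of characteristic
zero is complemented. -/
theorem stmt15 (k L : Type*) [Field k] [CharZero k] [LieRing L] [LieAlgebra k L]
    [FiniteDimensional k L] (hL : IsElementaryLieAlgebra k L) :
    ∀ B : LieSubalgebra k L, ∃ C : LieSubalgebra k L, B ⊓ C = ⊥ ∧ B ⊔ C = ⊤ := by
  intro B
  have hwf : WellFoundedLT (LieSubalgebra k L) :=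
    StrictMono.wellFoundedLT (f := LieSubalgebra.toSubmodule) fun _ _ h => h
  obtain ⟨C, hC⟩ := exists_minimal_of_wellFoundedLT (fun D : LieSubalgebra k L => B ⊔ D = ⊤)
    ⟨⊤, sup_top_eq B⟩
  exact ⟨C, LieSubalgebra.inf_eq_bot_of_minimal_supplement (hL C) hC, hC.prop⟩
end

section
/- Let L be a finite-dimensional Lie algebra over an algebraically closed field k of characteristic zero. Then L is elementary if and only if every Lie subalgebra of L (including L itself), regarded as a Lie algebra in its own right, is complemented. -/
/-- A Lie algebra is complemented if every Lie subalgebra `B` admits a Lie subalgebra `C` with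
`B ⊓ C = ⊥` and such that `B` and `C` together generate `L` (i.e. `B ⊔ C = ⊤`). -/
def IsComplementedLieAlgebra (k L : Type*) [Field k] [LieRing L] [LieAlgebra k L] : Prop :=
  ∀ B : LieSubalgebra k L, ∃ C : LieSubalgebra k L, B ⊓ C = ⊥ ∧ B ⊔ C = ⊤

/-- A finite-dimensional complemented Lie algebra has trivial Frattini subalgebra. -/
theorem IsComplementedLieAlgebra.lieFrattini_eq_bot {k L : Type*} [Field k] [LieRing L]
    [LieAlgebra k L] [FiniteDimensional k L] (h : IsComplementedLieAlgebra k L) :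
    lieFrattini k L = ⊥ := by
  obtain ⟨C, hinf, hsup⟩ := h (lieFrattini k L)
  rcases eq_top_or_exists_le_coatom C with rfl | ⟨M, hM, hCM⟩
  · rwa [inf_top_eq] at hinf
  · have hFM : lieFrattini k L ≤ M := sInf_le hM
    exact absurd (top_le_iff.mp (hsup ▸ sup_le hFM hCM)) hM.1

/-- If `C` is minimal among the subalgebras which together with `B` generate `S`, then
`B ⊓ C` lies in the Frattini subalgebra of `C`. -/
theorem mem_lieFrattini_of_minimal {k L : Type*} [Field k] [LieRing L] [LieAlgebra k L]
    {B S C : LieSubalgebra k L} (hC : Minimal (fun D => B ⊔ D = S) C) (x : C)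
    (hx : (x : L) ∈ B) : x ∈ lieFrattini k C := by
  rw [lieFrattini, ← SetLike.mem_coe, LieSubalgebra.coe_sInf, Set.mem_iInter₂]
  intro M hM
  by_contra hxM
  have hMC : M.map C.incl ≤ C := by
    rw [LieSubalgebra.map_le_iff_le_comap]
    exact fun y _ => y.2
  have hle : M ≤ (B ⊔ M.map C.incl).comap C.incl :=
    LieSubalgebra.map_le_iff_le_comap.mp le_sup_right
  have hxN : x ∈ (B ⊔ M.map C.incl).comap C.incl :=
    (le_sup_left : B ≤ B ⊔ M.map C.incl) hx
  have htop : (B ⊔ M.map C.incl).comap C.incl = ⊤ :=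
    hM.2 _ (lt_of_le_of_ne hle fun h => hxM (h ▸ hxN))
  have hCle : C ≤ B ⊔ M.map C.incl := fun y hy => by
    have : (⟨y, hy⟩ : C) ∈ (B ⊔ M.map C.incl).comap C.incl := htop ▸ LieSubalgebra.mem_top _
    exact this
  have hS : B ⊔ M.map C.incl = S :=
    le_antisymm ((sup_le_sup_left hMC B).trans hC.prop.le)
      (hC.prop.symm.le.trans (sup_le le_sup_left hCle))
  obtain ⟨y, hy, hyx⟩ := hC.le_of_le hS hMC x.2
  exact hxM (Subtype.ext hyx ▸ hy)

/-- In an elementary Lie algebra, complements exist relative to any subalgebra. -/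
theorem IsElementaryLieAlgebra.exists_inf_eq_bot_sup_eq {k L : Type*} [Field k] [LieRing L]
    [LieAlgebra k L] [FiniteDimensional k L] (h : IsElementaryLieAlgebra k L)
    {B S : LieSubalgebra k L} (hBS : B ≤ S) :
    ∃ C : LieSubalgebra k L, B ⊓ C = ⊥ ∧ B ⊔ C = S := by
  have : WellFoundedLT (LieSubalgebra k L) :=
    StrictMono.wellFoundedLT (f := LieSubalgebra.toSubmodule) fun _ _ hlt => hlt
  obtain ⟨C, hC⟩ := exists_minimal_of_wellFoundedLT (fun D => B ⊔ D = S) ⟨S, sup_eq_right.mpr hBS⟩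
  refine ⟨C, (LieSubalgebra.eq_bot_iff _).mpr fun x hx => ?_, hC.prop⟩
  obtain ⟨hxB, hxC⟩ := (LieSubalgebra.mem_inf _ _ _).mp hx
  have hF := mem_lieFrattini_of_minimal hC ⟨x, hxC⟩ hxB
  rw [h C, LieSubalgebra.mem_bot] at hF
  exact congrArg Subtype.val hF

/-- Every subalgebra of an elementary Lie algebra is complemented. -/
theorem IsElementaryLieAlgebra.isComplemented_subalgebra {k L : Type*} [Field k] [LieRing L]
    [LieAlgebra k L] [FiniteDimensional k L] (h : IsElementaryLieAlgebra k L)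
    (S : LieSubalgebra k L) : IsComplementedLieAlgebra k S := by
  intro U
  have hUS : U.map S.incl ≤ S := by
    rw [LieSubalgebra.map_le_iff_le_comap]
    exact fun y _ => y.2
  obtain ⟨C, hinf, hsup⟩ := h.exists_inf_eq_bot_sup_eq hUS
  refine ⟨C.comap S.incl, (LieSubalgebra.eq_bot_iff _).mpr fun x hx => ?_, ?_⟩
  · obtain ⟨hxU, hxC⟩ := (LieSubalgebra.mem_inf _ _ _).mp hx
    have hx0 : (x : L) ∈ U.map S.incl ⊓ C :=
      (LieSubalgebra.mem_inf _ _ _).mpr ⟨⟨x, hxU, rfl⟩, hxC⟩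
    rw [hinf, LieSubalgebra.mem_bot] at hx0
    exact Subtype.ext hx0
  · have hU : U.map S.incl ≤ (U ⊔ C.comap S.incl).map S.incl :=
      LieSubalgebra.map_le_iff_le_comap.mpr fun y hy =>
        ⟨y, (le_sup_left : U ≤ U ⊔ C.comap S.incl) hy, rfl⟩
    have hCS : C ≤ S := hsup ▸ le_sup_right
    have hC : C ≤ (U ⊔ C.comap S.incl).map S.incl := fun y hy =>
      ⟨⟨y, hCS hy⟩, (le_sup_right : C.comap S.incl ≤ U ⊔ C.comap S.incl) hy, rfl⟩
    refine top_le_iff.mp fun x _ => ?_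
    obtain ⟨y, hy, hyx⟩ := (hsup ▸ sup_le hU hC :) x.2
    exact Subtype.ext hyx ▸ hy

/-- over an algebraically closed field of characteristic zero, `L` is elementary
iff every Lie subalgebra of `L` (including `L` itself) is complemented. -/
theorem stmt16 (k L : Type*) [Field k] [CharZero k] [IsAlgClosed k]
    [LieRing L] [LieAlgebra k L] [FiniteDimensional k L] :
    IsElementaryLieAlgebra k L ↔
      (IsComplementedLieAlgebra k L ∧
        ∀ B : LieSubalgebra k L, IsComplementedLieAlgebra k B) := by
  refine ⟨fun h => ⟨fun _ => h.exists_inf_eq_bot_sup_eq le_top, h.isComplemented_subalgebra⟩, ?_⟩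
  exact fun h C => (h.2 C).lieFrattini_eq_bot
end

section
/- Let L₁ and L₂ be finite-dimensional Lie algebras over a field k of characteristic zero, and let ψ : L₁ → L₂ be a surjective Lie algebra homomorphism whose kernel is contained in the Frattini subalgebra F(L₁). Then ψ(F(L₁)) = F(L₂). -/
section Correspondence

variable {k L₁ L₂ : Type*} [Field k] [LieRing L₁] [LieAlgebra k L₁]
  [LieRing L₂] [LieAlgebra k L₂] {ψ : L₁ →ₗ⁅k⁆ L₂}

theorem mem_lieFrattini {x : L₁} :
    x ∈ lieFrattini k L₁ ↔ ∀ M : LieSubalgebra k L₁, IsCoatom M → x ∈ M := by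
  rw [lieFrattini, ← SetLike.mem_coe, LieSubalgebra.coe_sInf]
  simp

theorem LieSubalgebra.mem_of_apply_mem_map {K : LieSubalgebra k L₁}
    (hK : ∀ x, ψ x = 0 → x ∈ K) {x : L₁} (hx : ψ x ∈ K.map ψ) : x ∈ K := by
  obtain ⟨y, hy, hyx⟩ := (LieSubalgebra.mem_map _ _ _).1 hx
  have hxy : x - y ∈ K := hK _ (by rw [map_sub, hyx, sub_self])
  simpa using K.add_mem hxy hy

theorem LieSubalgebra.isCoatom_map (hsurj : Function.Surjective ψ) {M : LieSubalgebra k L₁}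
    (hM : IsCoatom M) (hker : ∀ x, ψ x = 0 → x ∈ M) : IsCoatom (M.map ψ) := by
  refine ⟨fun h => hM.1 (eq_top_iff.2 fun x _ => mem_of_apply_mem_map hker (h ▸ mem_top _)),
    fun N hN => ?_⟩
  obtain ⟨y, hyN, hyM⟩ := SetLike.exists_of_lt hN
  obtain ⟨x, rfl⟩ := hsurj y
  have htop : N.comap ψ = ⊤ := by
    refine hM.2 _ (SetLike.lt_iff_le_and_exists.2 ⟨fun z hz => ?_, x, hyN, fun hx => ?_⟩)
    · exact hN.le ((mem_map _ _ _).2 ⟨z, hz, rfl⟩)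
    · exact hyM ((mem_map _ _ _).2 ⟨x, hx, rfl⟩)
  refine eq_top_iff.2 fun z _ => ?_
  obtain ⟨w, rfl⟩ := hsurj z
  have hw : w ∈ N.comap ψ := htop ▸ mem_top w
  exact hw

theorem LieSubalgebra.isCoatom_comap (hsurj : Function.Surjective ψ) {N : LieSubalgebra k L₂}
    (hN : IsCoatom N) : IsCoatom (N.comap ψ) := by
  refine ⟨fun h => hN.1 (eq_top_iff.2 fun y _ => ?_), fun K hK => ?_⟩
  · obtain ⟨x, rfl⟩ := hsurj y
    have hx : x ∈ N.comap ψ := h ▸ mem_top x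
    exact hx
  · have hker : ∀ x, ψ x = 0 → x ∈ K := fun x hx => hK.le (show ψ x ∈ N from hx ▸ N.zero_mem)
    obtain ⟨x, hxK, hxN⟩ := SetLike.exists_of_lt hK
    have htop : K.map ψ = ⊤ := by
      refine hN.2 _ (SetLike.lt_iff_le_and_exists.2
        ⟨fun z hz => ?_, ψ x, (mem_map _ _ _).2 ⟨x, hxK, rfl⟩, hxN⟩)
      obtain ⟨w, rfl⟩ := hsurj z
      exact (mem_map _ _ _).2 ⟨w, hK.le hz, rfl⟩
    exact eq_top_iff.2 fun z _ => mem_of_apply_mem_map hker (htop ▸ mem_top _)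

end Correspondence

/-- if `ψ : L₁ → L₂` is a surjective Lie algebra homomorphism with
`ker ψ ⊆ F(L₁)`, then `ψ (F L₁) = F(L₂)`. -/
theorem stmt19 (k L₁ L₂ : Type*) [Field k] [CharZero k]
    [LieRing L₁] [LieAlgebra k L₁] [FiniteDimensional k L₁]
    [LieRing L₂] [LieAlgebra k L₂] [FiniteDimensional k L₂]
    (ψ : L₁ →ₗ⁅k⁆ L₂) (hsurj : Function.Surjective ψ)
    (hker : ∀ x : L₁, ψ x = 0 → x ∈ lieFrattini k L₁) :
    (lieFrattini k L₁).map ψ = lieFrattini k L₂ := by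
  ext y
  rw [LieSubalgebra.mem_map, mem_lieFrattini]
  constructor
  · rintro ⟨x, hx, rfl⟩ N hN
    exact mem_lieFrattini.1 hx _ (LieSubalgebra.isCoatom_comap hsurj hN)
  · intro hy
    obtain ⟨x, rfl⟩ := hsurj y
    refine ⟨x, mem_lieFrattini.2 fun M hM => ?_, rfl⟩
    have hkerM : ∀ z, ψ z = 0 → z ∈ M := fun z hz => mem_lieFrattini.1 (hker z hz) M hM
    exact LieSubalgebra.mem_of_apply_mem_map hkerM
      (hy _ (LieSubalgebra.isCoatom_map hsurj hM hkerM))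
end
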